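/- Let n ≥ 1, p > 1, q = p/(p-1). The constant (nπ/sin(π/p)) · (π^{n/2}/Γ(n/2 + 1)) is sharp: for every ε > 0 there exist nonnegative measurable functions f ∈ L^p(ℝⁿ) and g ∈ L^q(ℝⁿ), not almost everywhere zero, such that ∫_{ℝⁿ}∫_{ℝⁿ} (f(x) g(y)/(|x| + |y|)) |x|^{(1−n)/q} |y|^{(1−n)/p} dx dy > ((nπ/sin(π/p)) · (π^{n/2}/Γ(n/2 + 1)) − ε) · (∫_{ℝⁿ} f^p dx)^{1/p} · (∫_{ℝⁿ} g^q dy)^{1/q}. -/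

import Mathlib

open MeasureTheory Set ENNReal

/-- Polar coordinates for the lower Lebesgue integral of a radial function. -/
theorem lintegral_fun_norm_addHaar {E : Type*} [NormedAddCommGroup E] [NormedSpace ℝ E]
    [Nontrivial E] [FiniteDimensional ℝ E] [MeasurableSpace E] [BorelSpace E]
    (μ : Measure E) [μ.IsAddHaarMeasure] {h : ℝ → ℝ≥0∞} (hh : Measurable h) :
    ∫⁻ x, h ‖x‖ ∂μ = Module.finrank ℝ E * μ (Metric.ball 0 1) *
      ∫⁻ r in Ioi (0 : ℝ), ENNReal.ofReal (r ^ (Module.finrank ℝ E - 1)) * h r := by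
  have hsnd : Measurable fun r : Ioi (0 : ℝ) ↦ h r := hh.comp measurable_subtype_coe
  calc
    ∫⁻ x, h ‖x‖ ∂μ = ∫⁻ x : ({(0)}ᶜ : Set E), h ‖x.1‖ ∂(μ.comap (↑)) := by
      rw [lintegral_subtype_comap (measurableSet_singleton _).compl fun x ↦ h ‖x‖,
        restrict_compl_singleton]
    _ = ∫⁻ x, h x.2 ∂μ.toSphere.prod (.volumeIoiPow (Module.finrank ℝ E - 1)) := by
      simpa using μ.measurePreserving_homeomorphUnitSphereProd.lintegral_comp
        (hsnd.comp measurable_snd)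
    _ = μ.toSphere univ *
        ∫⁻ r : Ioi (0 : ℝ), h r ∂.volumeIoiPow (Module.finrank ℝ E - 1) := by
      simpa using lintegral_prod_mul (μ := μ.toSphere)
        (ν := .volumeIoiPow (Module.finrank ℝ E - 1)) (f := fun _ ↦ 1) aemeasurable_const
        hsnd.aemeasurable
    _ = _ := by
      rw [μ.toSphere_apply_univ, Measure.volumeIoiPow,
        lintegral_withDensity_eq_lintegral_mul _ (by fun_prop) hsnd,
        ← lintegral_subtype_comap measurableSet_Ioi]
      rfl

theorem lintegral_rpow_mul_exp_neg_mul_Ioi {a r : ℝ} (ha : 0 < a) (hr : 0 < r) :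
    ∫⁻ t in Ioi (0 : ℝ), ENNReal.ofReal (t ^ (a - 1) * Real.exp (-(r * t))) =
      ENNReal.ofReal ((1 / r) ^ a * Real.Gamma a) := by
  have h := Real.integral_rpow_mul_exp_neg_mul_Ioi ha hr
  rw [← h, ofReal_integral_eq_lintegral_ofReal]
  · refine .of_integral_ne_zero ?_
    rw [h]
    have := Real.Gamma_pos_of_pos ha
    positivity
  · filter_upwards [ae_restrict_mem measurableSet_Ioi] with t ht
    have : 0 < t := ht
    simp only [Pi.zero_apply]
    positivity

/-- The reflection formula as the value of the Mellin transform of `1 / (1 + t)`. -/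
theorem lintegral_rpow_div_one_add_Ioi {a : ℝ} (ha : 0 < a) (ha' : a < 1) :
    ∫⁻ t in Ioi (0 : ℝ), ENNReal.ofReal (t ^ (a - 1) / (1 + t)) =
      ENNReal.ofReal (Real.pi / Real.sin (Real.pi * a)) := by
  calc
    _ = ∫⁻ t in Ioi (0 : ℝ), ∫⁻ s in Ioi (0 : ℝ),
        ENNReal.ofReal (t ^ (a - 1) * Real.exp (-((1 + t) * s))) := by
      refine setLIntegral_congr_fun measurableSet_Ioi fun t ht ↦ ?_
      have ht : 0 < t := ht
      have h := lintegral_rpow_mul_exp_neg_mul_Ioi one_pos (add_pos one_pos ht)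
      simp only [sub_self, Real.rpow_zero, one_mul, Real.rpow_one, Real.Gamma_one, mul_one] at h
      simp_rw [ENNReal.ofReal_mul (Real.rpow_nonneg ht.le _)]
      rw [lintegral_const_mul _ (by fun_prop), h, ← ENNReal.ofReal_mul (by positivity),
        mul_one_div]
    _ = ∫⁻ s in Ioi (0 : ℝ), ∫⁻ t in Ioi (0 : ℝ),
        ENNReal.ofReal (t ^ (a - 1) * Real.exp (-((1 + t) * s))) :=
      lintegral_lintegral_swap (by fun_prop)
    _ = ∫⁻ s in Ioi (0 : ℝ), ENNReal.ofReal (Real.Gamma a) *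
        ENNReal.ofReal (s ^ ((1 - a) - 1) * Real.exp (-(1 * s))) := by
      refine setLIntegral_congr_fun measurableSet_Ioi fun s hs ↦ ?_
      have hs : 0 < s := hs
      have h (t : ℝ) : ENNReal.ofReal (t ^ (a - 1) * Real.exp (-((1 + t) * s))) =
          ENNReal.ofReal (Real.exp (-s)) *
            ENNReal.ofReal (t ^ (a - 1) * Real.exp (-(s * t))) := by
        rw [← ENNReal.ofReal_mul (by positivity), mul_left_comm, ← Real.exp_add]
        ring_nf
      simp_rw [h]
      rw [lintegral_const_mul _ (by fun_prop), lintegral_rpow_mul_exp_neg_mul_Ioi ha hs,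
        ← ENNReal.ofReal_mul (by positivity),
        ← ENNReal.ofReal_mul (Real.Gamma_pos_of_pos ha).le, one_div, Real.inv_rpow hs.le,
        ← Real.rpow_neg hs.le]
      ring_nf
    _ = _ := by
      rw [lintegral_const_mul _ (by fun_prop),
        lintegral_rpow_mul_exp_neg_mul_Ioi (sub_pos.2 ha') one_pos,
        ← ENNReal.ofReal_mul (Real.Gamma_pos_of_pos ha).le, div_one, Real.one_rpow, one_mul,
        Real.Gamma_mul_Gamma_one_sub]

theorem exists_lt_setLIntegral_Icc_inv {h : ℝ → ℝ≥0∞} {c : ℝ≥0∞}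
    (hc : c < ∫⁻ t in Ioi (0 : ℝ), h t) :
    ∃ M : ℝ, 1 ≤ M ∧ c < ∫⁻ t in Icc M⁻¹ M, h t := by
  have hmono : Monotone fun k : ℕ ↦ Icc ((k : ℝ) + 1)⁻¹ (k + 1) := by
    intro i j hij
    have : (i : ℝ) ≤ j := by exact_mod_cast hij
    exact Icc_subset_Icc (by gcongr) (by gcongr)
  have hunion : Ioi (0 : ℝ) = ⋃ k : ℕ, Icc ((k : ℝ) + 1)⁻¹ (k + 1) := by
    ext t
    simp only [mem_Ioi, mem_iUnion, mem_Icc]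
    constructor
    · intro ht
      obtain ⟨k, hk⟩ := exists_nat_ge (max t t⁻¹)
      have h1 := (le_max_left _ _).trans hk
      have h2 := (le_max_right _ _).trans hk
      exact ⟨k, inv_le_of_inv_le₀ ht (by linarith), by linarith⟩
    · rintro ⟨k, hk, -⟩
      exact lt_of_lt_of_le (by positivity) hk
  rw [hunion, setLIntegral_iUnion_of_directed _ hmono.directed_le, lt_iSup_iff] at hc
  obtain ⟨k, hk⟩ := hc
  exact ⟨k + 1, by simp, hk⟩

theorem lintegral_inv_Icc {a b : ℝ} (ha : 0 < a) (hab : a ≤ b) :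
    ∫⁻ r in Icc a b, ENNReal.ofReal r⁻¹ = ENNReal.ofReal (Real.log (b / a)) := by
  have h0 : (0 : ℝ) ∉ uIcc a b := by
    rw [uIcc_of_le hab]
    exact fun h ↦ ha.not_ge h.1
  rw [← integral_inv h0, intervalIntegral.integral_of_le hab, ← integral_Icc_eq_integral_Ioc,
    ofReal_integral_eq_lintegral_ofReal]
  · refine (ContinuousOn.integrableOn_Icc ?_)
    exact continuousOn_inv₀.mono fun x hx ↦ (ha.trans_le hx.1).ne'
  · filter_upwards [ae_restrict_mem measurableSet_Icc] with t ht
    exact inv_nonneg.2 (ha.le.trans ht.1)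

/-- The substitution `r = s * t`, restricted to a window that works for all `s ∈ [1, R]`. -/
theorem setLIntegral_rpow_div_one_add_mul_le {a s M R : ℝ} (hs : 1 ≤ s) (hsR : s ≤ R)
    (hM : 1 ≤ M) :
    ENNReal.ofReal (s ^ (a - 1)) *
        ∫⁻ t in Icc M⁻¹ M, ENNReal.ofReal (t ^ (a - 1) / (1 + t)) ≤
      ∫⁻ r in Icc M⁻¹ (M * R), ENNReal.ofReal (r ^ (a - 1) / (r + s)) := by
  have hs0 : 0 < s := by linarith
  have hM0 : 0 < M := by linarith
  have himage : (s * ·) '' Icc M⁻¹ M ⊆ Icc M⁻¹ (M * R) := by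
    rintro _ ⟨t, ht, rfl⟩
    have hMinv : 0 < M⁻¹ := by positivity
    exact ⟨by nlinarith [ht.1], by nlinarith [ht.2]⟩
  refine le_trans (le_of_eq ?_) (lintegral_mono_set himage)
  rw [lintegral_image_eq_lintegral_abs_deriv_mul (f' := fun _ ↦ s) measurableSet_Icc
    (fun x _ ↦ by simpa using ((hasDerivAt_id x).const_mul s).hasDerivWithinAt)
    (mul_right_injective₀ hs0.ne').injOn, ← lintegral_const_mul _ (by fun_prop)]
  refine setLIntegral_congr_fun measurableSet_Icc fun t ht ↦ ?_
  have ht0 : 0 < t := lt_of_lt_of_le (by positivity) ht.1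
  rw [← ENNReal.ofReal_mul (by positivity), ← ENNReal.ofReal_mul (by positivity),
    Real.mul_rpow hs0.le ht0.le, abs_of_pos hs0]
  congr 1
  field_simp
  ring

/-- The power `r ^ e` truncated to the interval `[a, b]`. -/
noncomputable def truncRpow (a b e : ℝ) : ℝ → ℝ≥0∞ :=
  (Icc a b).indicator fun r ↦ ENNReal.ofReal (r ^ e)

theorem measurable_truncRpow (a b e : ℝ) : Measurable (truncRpow a b e) :=
  Measurable.indicator (by fun_prop) measurableSet_Icc

theorem measurable_truncRpow_norm {E : Type*} [NormedAddCommGroup E] [MeasurableSpace E]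
    [OpensMeasurableSpace E] (a b e : ℝ) : Measurable fun x : E ↦ truncRpow a b e ‖x‖ :=
  (measurable_truncRpow a b e).comp measurable_norm

theorem truncRpow_rpow {a b : ℝ} (ha : 0 < a) (e : ℝ) {p : ℝ} (hp : 0 < p) (r : ℝ) :
    truncRpow a b e r ^ p = truncRpow a b (e * p) r := by
  by_cases hr : r ∈ Icc a b
  · have hr0 : 0 < r := ha.trans_le hr.1
    simp only [truncRpow, indicator_of_mem hr]
    rw [ENNReal.ofReal_rpow_of_nonneg (by positivity) hp.le, Real.rpow_mul hr0.le]
  · simp [truncRpow, indicator_of_notMem hr, hp]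

/-- The surface area of the unit sphere of `ℝⁿ`. -/
noncomputable def sphereArea (n : ℕ) : ℝ :=
  n * (Real.pi ^ ((n : ℝ) / 2) / Real.Gamma ((n : ℝ) / 2 + 1))

theorem sphereArea_pos {n : ℕ} (hn : 1 ≤ n) : 0 < sphereArea n := by
  have hn' : (0 : ℝ) < n := by exact_mod_cast hn
  have := Real.Gamma_pos_of_pos (show (0 : ℝ) < (n : ℝ) / 2 + 1 by positivity)
  have := Real.pi_pos
  unfold sphereArea
  positivity

theorem EuclideanSpace.lintegral_fun_norm {n : ℕ} (hn : 1 ≤ n) {h : ℝ → ℝ≥0∞}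
    (hh : Measurable h) :
    ∫⁻ x : EuclideanSpace ℝ (Fin n), h ‖x‖ = ENNReal.ofReal (sphereArea n) *
      ∫⁻ r in Ioi (0 : ℝ), ENNReal.ofReal (r ^ ((n : ℝ) - 1)) * h r := by
  have : Nonempty (Fin n) := ⟨⟨0, hn⟩⟩
  rw [lintegral_fun_norm_addHaar volume hh, EuclideanSpace.volume_ball, finrank_euclideanSpace,
    Fintype.card_fin, sphereArea, ENNReal.ofReal_mul (by positivity), ENNReal.ofReal_natCast,
    ENNReal.ofReal_one, one_pow, one_mul, Real.sqrt_eq_rpow, ← Real.rpow_mul_natCast Real.pi_pos.le,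
    one_div_mul_eq_div]
  simp_rw [← Real.rpow_natCast, Nat.cast_sub hn, Nat.cast_one]

theorem lintegral_truncRpow_norm {n : ℕ} (hn : 1 ≤ n) {a b : ℝ} (ha : 0 < a) (hab : a ≤ b) :
    ∫⁻ x : EuclideanSpace ℝ (Fin n), truncRpow a b (-n) ‖x‖ =
      ENNReal.ofReal (sphereArea n * Real.log (b / a)) := by
  rw [EuclideanSpace.lintegral_fun_norm hn (measurable_truncRpow _ _ _),
    ENNReal.ofReal_mul (sphereArea_pos hn).le, ← lintegral_inv_Icc ha hab]
  congr 1
  have hmul (r : ℝ) : ENNReal.ofReal (r ^ ((n : ℝ) - 1)) * truncRpow a b (-n) r =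
      (Icc a b).indicator (fun r ↦ ENNReal.ofReal (r ^ ((n : ℝ) - 1)) *
        ENNReal.ofReal (r ^ (-(n : ℝ)))) r := by
    rw [truncRpow, indicator_mul_right]
  simp_rw [hmul]
  rw [setLIntegral_indicator measurableSet_Icc,
    inter_eq_left.2 fun r hr ↦ mem_Ioi.2 (ha.trans_le hr.1)]
  refine setLIntegral_congr_fun measurableSet_Icc fun r hr ↦ ?_
  have hr0 : 0 < r := ha.trans_le hr.1
  rw [← ENNReal.ofReal_mul (by positivity), ← Real.rpow_add hr0, ← Real.rpow_neg_one]
  ring_nf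

theorem lintegral_truncRpow_norm_rpow {n : ℕ} (hn : 1 ≤ n) {a b p : ℝ} (ha : 0 < a)
    (hab : a ≤ b) (hp : 0 < p) :
    ∫⁻ x : EuclideanSpace ℝ (Fin n), truncRpow a b (-n / p) ‖x‖ ^ p =
      ENNReal.ofReal (sphereArea n * Real.log (b / a)) := by
  simp_rw [truncRpow_rpow ha _ hp, div_mul_cancel₀ _ hp.ne']
  exact lintegral_truncRpow_norm hn ha hab

theorem not_ae_eq_zero_of_lintegral_rpow_pos {α : Type*} [MeasurableSpace α] {μ : Measure α}
    {f : α → ℝ≥0∞} {p : ℝ} (hp : 0 < p) (h : 0 < ∫⁻ x, f x ^ p ∂μ) : ¬ ∀ᵐ x ∂μ, f x = 0 := by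
  intro h0
  refine h.ne' ?_
  refine lintegral_eq_zero_of_ae_eq_zero (h0.mono fun x hx ↦ ?_)
  simp [hx, hp]

theorem le_lintegral_hardyHilbert_inner {n : ℕ} (hn : 1 ≤ n) {p q M R : ℝ}
    (hpq : p.HolderConjugate q) (hM : 1 ≤ M) (y : EuclideanSpace ℝ (Fin n)) :
    ENNReal.ofReal (sphereArea n) *
        (∫⁻ t in Icc M⁻¹ M, ENNReal.ofReal (t ^ (-1 / p) / (1 + t))) *
        truncRpow 1 R (-n) ‖y‖ ≤
      ∫⁻ x : EuclideanSpace ℝ (Fin n),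
        truncRpow M⁻¹ (M * R) (-n / p) ‖x‖ * truncRpow 1 R (-n / q) ‖y‖ /
          ENNReal.ofReal (‖x‖ + ‖y‖) *
          ENNReal.ofReal (‖x‖ ^ ((1 - (n : ℝ)) / q) * ‖y‖ ^ ((1 - (n : ℝ)) / p)) := by
  by_cases hy : ‖y‖ ∈ Icc 1 R
  swap
  · simp [truncRpow, indicator_of_notMem hy]
  set s := ‖y‖ with hs
  have hs0 : 0 < s := by linarith [hy.1]
  have hM0 : 0 < M⁻¹ := by positivity
  have hp := hpq.pos
  have hq := hpq.symm.pos
  have hinv : q⁻¹ = 1 - p⁻¹ := by linarith [hpq.inv_add_inv_eq_one]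
  have hexp : -1 / p = (1 - p⁻¹) - 1 := by ring
  rw [EuclideanSpace.lintegral_fun_norm hn (h := fun r ↦
    truncRpow M⁻¹ (M * R) (-n / p) r * truncRpow 1 R (-n / q) s / ENNReal.ofReal (r + s) *
      ENNReal.ofReal (r ^ ((1 - (n : ℝ)) / q) * s ^ ((1 - (n : ℝ)) / p)))
    (by have := measurable_truncRpow M⁻¹ (M * R) (-n / p); fun_prop), mul_assoc]
  gcongr
  calc
    _ = ENNReal.ofReal (s ^ (-n - (-1 / p))) * (ENNReal.ofReal (s ^ (-1 / p)) *
        ∫⁻ t in Icc M⁻¹ M, ENNReal.ofReal (t ^ (-1 / p) / (1 + t))) := by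
      simp only [truncRpow, indicator_of_mem hy]
      rw [← mul_assoc, ← ENNReal.ofReal_mul (by positivity), ← Real.rpow_add hs0,
        sub_add_cancel, mul_comm]
    _ ≤ ENNReal.ofReal (s ^ (-n - (-1 / p))) *
        ∫⁻ r in Icc M⁻¹ (M * R), ENNReal.ofReal (r ^ (-1 / p) / (r + s)) := by
      rw [hexp]
      gcongr
      exact setLIntegral_rpow_div_one_add_mul_le hy.1 hy.2 hM
    _ = ∫⁻ r in Icc M⁻¹ (M * R), ENNReal.ofReal (s ^ (-n - (-1 / p))) *
        ENNReal.ofReal (r ^ (-1 / p) / (r + s)) := by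
      rw [lintegral_const_mul _ (by fun_prop)]
    _ ≤ _ := by
      refine le_trans (le_of_eq ?_)
        (lintegral_mono_set fun r (hr : r ∈ Icc M⁻¹ (M * R)) ↦ lt_of_lt_of_le hM0 hr.1)
      refine setLIntegral_congr_fun measurableSet_Icc fun r hr ↦ ?_
      have hr0 : 0 < r := hM0.trans_le hr.1
      have h1 : s ^ (-n - (-1 / p)) = s ^ (-n / q) * s ^ ((1 - (n : ℝ)) / p) := by
        rw [← Real.rpow_add hs0, div_eq_mul_inv _ q, hinv]
        ring_nf
      have h2 : r ^ (-1 / p) =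
          r ^ ((n : ℝ) - 1) * (r ^ (-n / p) * r ^ ((1 - (n : ℝ)) / q)) := by
        rw [← Real.rpow_add hr0, ← Real.rpow_add hr0, div_eq_mul_inv _ q, hinv]
        ring_nf
      simp only [truncRpow, indicator_of_mem hy, indicator_of_mem hr]
      rw [← ENNReal.ofReal_mul (by positivity), ← ENNReal.ofReal_mul (by positivity),
        ← ENNReal.ofReal_div_of_pos (by positivity), ← ENNReal.ofReal_mul (by positivity),
        ← ENNReal.ofReal_mul (by positivity), h1, h2]
      ring_nf

/-- Lower bound for the Hardy–Hilbert form on truncated powers; the interval carrying the first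
factor exceeds the one carrying the second by a factor `M` on both sides. -/
theorem le_lintegral_hardyHilbert {n : ℕ} (hn : 1 ≤ n) {p q M R : ℝ}
    (hpq : p.HolderConjugate q) (hM : 1 ≤ M) (hR : 1 ≤ R) :
    ENNReal.ofReal (sphereArea n) *
        (∫⁻ t in Icc M⁻¹ M, ENNReal.ofReal (t ^ (-1 / p) / (1 + t))) *
        ENNReal.ofReal (sphereArea n * Real.log R) ≤
      ∫⁻ y : EuclideanSpace ℝ (Fin n), ∫⁻ x : EuclideanSpace ℝ (Fin n),
        truncRpow M⁻¹ (M * R) (-n / p) ‖x‖ * truncRpow 1 R (-n / q) ‖y‖ /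
          ENNReal.ofReal (‖x‖ + ‖y‖) *
          ENNReal.ofReal (‖x‖ ^ ((1 - (n : ℝ)) / q) * ‖y‖ ^ ((1 - (n : ℝ)) / p)) := by
  refine le_trans (le_of_eq ?_)
    (lintegral_mono fun y ↦ le_lintegral_hardyHilbert_inner hn hpq hM y)
  rw [lintegral_const_mul _ (measurable_truncRpow_norm _ _ _),
    lintegral_truncRpow_norm hn one_pos hR, div_one]

theorem mul_rpow_mul_rpow_lt_of_holderConjugate {p q c d e m L : ℝ}
    (hpq : p.HolderConjugate q) (hc : 0 < c) (hd : 0 ≤ d) (hm : 0 ≤ m) (hL : 0 < L)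
    (h : d * (L + m) < e * L) :
    d * (c * (L + m)) ^ (1 / p) * (c * L) ^ (1 / q) < e * (c * L) := by
  have hmono : (c * L) ^ (1 / q) ≤ (c * (L + m)) ^ (1 / q) :=
    Real.rpow_le_rpow (by positivity) (by gcongr; linarith) hpq.symm.one_div_nonneg
  have hsum : 1 / p + 1 / q = 1 := by simpa using hpq.inv_add_inv_eq_one
  calc
    _ ≤ d * (c * (L + m)) ^ (1 / p) * (c * (L + m)) ^ (1 / q) := by gcongr
    _ = c * (d * (L + m)) := by
      rw [mul_assoc, ← Real.rpow_add (by positivity), hsum, Real.rpow_one]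
      ring
    _ < c * (e * L) := by gcongr
    _ = e * (c * L) := by ring

/-- Sharpness of the constant `(nπ/sin(π/p)) (π^{n/2}/Γ(n/2+1))` in the
Hardy–Hilbert type inequality on `ℝⁿ` with the Euclidean norm. -/
theorem stmt_14 (n : ℕ) (hn : 1 ≤ n) (p q : ℝ) (hp : 1 < p) (hq : q = p / (p - 1)) :
    ∀ ε : ℝ, 0 < ε →
      ∃ f g : EuclideanSpace ℝ (Fin n) → ℝ≥0∞, Measurable f ∧ Measurable g ∧
        (∫⁻ x, f x ^ p < ⊤) ∧ (∫⁻ y, g y ^ q < ⊤) ∧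
        ¬ (∀ᵐ x, f x = 0) ∧ ¬ (∀ᵐ y, g y = 0) ∧
        ENNReal.ofReal ((n * Real.pi / Real.sin (Real.pi / p)) *
              (Real.pi ^ ((n : ℝ) / 2) / Real.Gamma ((n : ℝ) / 2 + 1)) - ε) *
            (∫⁻ x, f x ^ p) ^ (1 / p) * (∫⁻ y, g y ^ q) ^ (1 / q) <
          ∫⁻ y, ∫⁻ x,
            f x * g y / ENNReal.ofReal (‖x‖ + ‖y‖) *
              ENNReal.ofReal (‖x‖ ^ ((1 - (n : ℝ)) / q) *
                ‖y‖ ^ ((1 - (n : ℝ)) / p)) := by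
  intro ε hε
  have hpq : p.HolderConjugate q := hq ▸ Real.HolderConjugate.conjExponent hp
  have hp0 := hpq.pos
  have hq0 := hpq.symm.pos
  set c := sphereArea n with hc
  have hc0 : 0 < c := sphereArea_pos hn
  set K := Real.pi / Real.sin (Real.pi / p) with hK
  have hK0 : 0 < K := div_pos Real.pi_pos
    (Real.sin_pos_of_pos_of_lt_pi (by positivity) (div_lt_self Real.pi_pos hp))
  have hconst : n * Real.pi / Real.sin (Real.pi / p) *
      (Real.pi ^ ((n : ℝ) / 2) / Real.Gamma ((n : ℝ) / 2 + 1)) = c * K := by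
    rw [hc, hK, sphereArea]
    ring
  rw [hconst]
  have hlt : max (c * K - ε) 0 / c < K := by
    rw [div_lt_iff₀ hc0]
    exact max_lt (by linarith) (by positivity)
  obtain ⟨k, hk, hkK⟩ := exists_between hlt
  have hd0 : 0 ≤ max (c * K - ε) 0 := le_max_right _ _
  have hk0 : 0 ≤ k := le_trans (by positivity) hk.le
  rw [div_lt_iff₀ hc0] at hk
  have hKint : ENNReal.ofReal k <
      ∫⁻ t in Ioi (0 : ℝ), ENNReal.ofReal (t ^ (-1 / p) / (1 + t)) := by
    have h := lintegral_rpow_div_one_add_Ioi (sub_pos.2 (inv_lt_one_of_one_lt₀ hp))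
      (sub_lt_self 1 (inv_pos.2 hp0))
    rw [show 1 - p⁻¹ - 1 = -1 / p by ring,
      show Real.pi * (1 - p⁻¹) = Real.pi - Real.pi / p by ring, Real.sin_pi_sub] at h
    rw [h]
    exact (ENNReal.ofReal_lt_ofReal_iff hK0).2 hkK
  obtain ⟨M, hM, hkM⟩ := exists_lt_setLIntegral_Icc_inv hKint
  have hM0 : 0 < M := by linarith
  set d := max (c * K - ε) 0 with hd
  set m := 2 * Real.log M with hm
  have hm0 : 0 ≤ m := mul_nonneg two_pos.le (Real.log_nonneg hM)
  obtain ⟨L, hL0, hL⟩ : ∃ L : ℝ, 0 < L ∧ d * (L + m) < k * c * L := by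
    have hkd : 0 < k * c - d := sub_pos.2 hk
    refine ⟨d * m / (k * c - d) + 1, by positivity, ?_⟩
    have := div_mul_cancel₀ (d * m) hkd.ne'
    nlinarith
  set R := Real.exp L with hR
  have hR1 : 1 ≤ R := Real.one_le_exp hL0.le
  have hlogR : Real.log R = L := Real.log_exp L
  have hlogMR : Real.log (M * R / M⁻¹) = L + m := by
    rw [div_inv_eq_mul, Real.log_mul (by positivity) hM0.ne',
      Real.log_mul hM0.ne' (by positivity), hlogR]
    ring
  have hab : M⁻¹ ≤ M * R :=
    (inv_le_one_of_one_le₀ hM).trans (one_le_mul_of_one_le_of_one_le hM hR1)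
  have hf := lintegral_truncRpow_norm_rpow hn (inv_pos.2 hM0) hab hp0
  have hg := lintegral_truncRpow_norm_rpow hn one_pos hR1 hq0
  rw [hlogMR] at hf
  rw [div_one, hlogR] at hg
  refine ⟨fun x ↦ truncRpow M⁻¹ (M * R) (-n / p) ‖x‖, fun y ↦ truncRpow 1 R (-n / q) ‖y‖,
    measurable_truncRpow_norm _ _ _, measurable_truncRpow_norm _ _ _,
    hf ▸ ENNReal.ofReal_lt_top, hg ▸ ENNReal.ofReal_lt_top,
    not_ae_eq_zero_of_lintegral_rpow_pos hp0 ?_, not_ae_eq_zero_of_lintegral_rpow_pos hq0 ?_, ?_⟩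
  · rw [hf]
    exact ENNReal.ofReal_pos.2 (by positivity)
  · rw [hg]
    exact ENNReal.ofReal_pos.2 (by positivity)
  refine lt_of_lt_of_le ?_ (le_lintegral_hardyHilbert hn hpq hM hR1)
  rw [hf, hg, hlogR, ← hc]
  calc
    _ ≤ ENNReal.ofReal d * ENNReal.ofReal (c * (L + m)) ^ (1 / p) *
        ENNReal.ofReal (c * L) ^ (1 / q) := by
      gcongr
      exact le_max_left _ _
    _ = ENNReal.ofReal (d * (c * (L + m)) ^ (1 / p) * (c * L) ^ (1 / q)) := by
      rw [ENNReal.ofReal_rpow_of_nonneg (by positivity) (by positivity),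
        ENNReal.ofReal_rpow_of_nonneg (by positivity) (by positivity),
        ← ENNReal.ofReal_mul hd0, ← ENNReal.ofReal_mul (by positivity)]
    _ < ENNReal.ofReal (k * c * (c * L)) := by
      refine (ENNReal.ofReal_lt_ofReal_iff_of_nonneg (by positivity)).2 ?_
      exact mul_rpow_mul_rpow_lt_of_holderConjugate hpq hc0 hd0 hm0 hL0 hL
    _ = ENNReal.ofReal c * ENNReal.ofReal k * ENNReal.ofReal (c * L) := by
      rw [← ENNReal.ofReal_mul hc0.le, ← ENNReal.ofReal_mul (by positivity), mul_comm k c]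
    _ ≤ _ := by gcongr
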